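/- (Master lemma for three-valued middle outcome.) Let Q ≥ 2 be an integer, let π_1, π_3 ∈ ℝ, and let π_{2,1}, π_{2,2} : {1,…,Q} → ℝ satisfy π_{2,1}(w) > π_{2,2}(w) for all w. Let p_1(1) = Λ(π_1), p_1(0) = 1 − Λ(π_1); for each w let p_2(1|w) = 1 − Λ(π_{2,1}(w)), p_2(2|w) = Λ(π_{2,1}(w)) − Λ(π_{2,2}(w)), p_2(3|w) = Λ(π_{2,2}(w)); let p_3(1|2,w) = Λ(π_3) and p_3(0|2,w) = 1 − Λ(π_3) for all w; let f(·|ỹ_1) : {1,…,Q} → [0,1] with Σ_{w=1}^{Q} f(w|ỹ_1) = 1 for each ỹ_1 ∈ {0,1}; and let p_3(·|1,w), p_3(·|3,w) : {0,1} → [0,1] be arbitrary with p_3(0|ỹ_2,w) + p_3(1|ỹ_2,w) = 1 for ỹ_2 ∈ {1,3} and each w. Define m(ỹ_1, ỹ_2, ỹ_3, w) casewise by: exp(π_1 − π_3)·(exp(π_3 − π_{2,2}(w)) − 1)/(exp(π_{2,1}(w) − π_{2,2}(w)) − 1) if (ỹ_1, ỹ_2, ỹ_3) = (0,2,0); exp(π_1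 − π_3)·(1 − exp(π_{2,2}(w) − π_3))/(1 − exp(π_{2,2}(w) − π_{2,1}(w))) if (ỹ_1, ỹ_2, ỹ_3) = (0,2,1); exp(π_1 − π_3) if ỹ_1 = 0 and ỹ_2 = 3; −1 if ỹ_1 = 1 and ỹ_2 = 1; −(1 − exp(π_3 − π_{2,1}(w)))/(1 − exp(π_{2,2}(w) − π_{2,1}(w))) if (ỹ_1, ỹ_2, ỹ_3) = (1,2,0); −(exp(π_{2,1}(w) − π_3) − 1)/(exp(π_{2,1}(w) − π_{2,2}(w)) − 1) if (ỹ_1, ỹ_2, ỹ_3) = (1,2,1); and 0 otherwise. Then Σ_{ỹ_1 ∈ {0,1}} Σ_{w=1}^{Q} Σ_{ỹ_2 ∈ {1,2,3}} Σ_{ỹ_3 ∈ {0,1}} m(ỹ_1, ỹ_2, ỹ_3, w) · p_3(ỹ_3|ỹ_2, w) · p_2(ỹ_2|w) · f(w|ỹ_1) · p_1(ỹ_1) = 0. -/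

import Mathlib

open Finset

/-- The logistic CDF `Λ(u) = 1/(1+exp(-u))`. -/
noncomputable def Lam (u : ℝ) : ℝ := 1 / (1 + Real.exp (-u))

lemma Lam_eq (u : ℝ) : Lam u = Real.exp u / (1 + Real.exp u) := by
  unfold Lam
  rw [Real.exp_neg]
  have := Real.exp_pos u
  field_simp
  ring

lemma core0 (π1 π3 x y : ℝ) (h : y < x) :
    Real.exp (π1 - π3) * ((Real.exp (π3 - y) - 1) / (Real.exp (x - y) - 1)) * (1 - Lam π3)
        * (Lam x - Lam y)
      + Real.exp (π1 - π3) * ((1 - Real.exp (y - π3)) / (1 - Real.exp (y - x))) * Lam π3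
        * (Lam x - Lam y)
      + Real.exp (π1 - π3) * Lam y = Real.exp π1 * (1 - Lam π3) := by
  simp only [Lam_eq, Real.exp_sub]
  have hab := Real.exp_lt_exp.mpr h
  have ha := Real.exp_pos x
  have hb := Real.exp_pos y
  have hc := Real.exp_pos π3
  generalize Real.exp x = a at *
  generalize Real.exp y = b at *
  generalize Real.exp π3 = c at *
  have hd : a - b ≠ 0 := by linarith
  have e1 : (c / b - 1) / (a / b - 1) = (c - b) / (a - b) := by
    rw [div_sub_one hb.ne', div_sub_one hb.ne', div_div_div_cancel_right₀ hb.ne']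
  have e2 : (1 - b / c) / (1 - b / a) = a * (c - b) / (c * (a - b)) := by
    rw [one_sub_div hc.ne', one_sub_div ha.ne']
    field_simp
  rw [e1, e2]
  field_simp
  ring

lemma core1 (π3 x y : ℝ) (h : y < x) :
    -((1 - Real.exp (π3 - x)) / (1 - Real.exp (y - x))) * (1 - Lam π3) * (Lam x - Lam y)
      + -((Real.exp (x - π3) - 1) / (Real.exp (x - y) - 1)) * Lam π3 * (Lam x - Lam y)
      - (1 - Lam x) = - (1 - Lam π3) := by
  simp only [Lam_eq, Real.exp_sub]
  have hab := Real.exp_lt_exp.mpr h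
  have ha := Real.exp_pos x
  have hb := Real.exp_pos y
  have hc := Real.exp_pos π3
  generalize Real.exp x = a at *
  generalize Real.exp y = b at *
  generalize Real.exp π3 = c at *
  have hd : a - b ≠ 0 := by linarith
  have e1 : (1 - c / a) / (1 - b / a) = (a - c) / (a - b) := by
    rw [one_sub_div ha.ne', one_sub_div ha.ne', div_div_div_cancel_right₀ ha.ne']
  have e2 : (a / c - 1) / (a / b - 1) = b * (a - c) / (c * (a - b)) := by
    rw [div_sub_one hc.ne', div_sub_one hb.ne']
    field_simp
  rw [e1, e2]
  field_simp
  ring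

theorem statement6 (Q : ℕ) (hQ : 2 ≤ Q) (π1 π3 : ℝ) (π21 π22 : ℕ → ℝ)
    (hπ : ∀ w ∈ Finset.Icc 1 Q, π22 w < π21 w)
    (f : ℕ → ℕ → ℝ)
    (hf01 : ∀ y1 ∈ Finset.range 2, ∀ w ∈ Finset.Icc 1 Q, 0 ≤ f y1 w ∧ f y1 w ≤ 1)
    (hfsum : ∀ y1 ∈ Finset.range 2, ∑ w ∈ Finset.Icc 1 Q, f y1 w = 1)
    (p3 : ℕ → ℕ → ℕ → ℝ)
    (hp3two0 : ∀ w ∈ Finset.Icc 1 Q, p3 0 2 w = 1 - Lam π3)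
    (hp3two1 : ∀ w ∈ Finset.Icc 1 Q, p3 1 2 w = Lam π3)
    (hp3rng : ∀ y2 ∈ ({1, 3} : Finset ℕ), ∀ w ∈ Finset.Icc 1 Q, ∀ y3 ∈ Finset.range 2,
        0 ≤ p3 y3 y2 w ∧ p3 y3 y2 w ≤ 1)
    (hp3sum : ∀ y2 ∈ ({1, 3} : Finset ℕ), ∀ w ∈ Finset.Icc 1 Q,
        p3 0 y2 w + p3 1 y2 w = 1) :
    (∑ y1 ∈ Finset.range 2, ∑ w ∈ Finset.Icc 1 Q,
      ∑ y2 ∈ Finset.Icc 1 3, ∑ y3 ∈ Finset.range 2,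
      (if y1 = 0 ∧ y2 = 2 ∧ y3 = 0 then
          Real.exp (π1 - π3) *
            ((Real.exp (π3 - π22 w) - 1) / (Real.exp (π21 w - π22 w) - 1))
        else if y1 = 0 ∧ y2 = 2 ∧ y3 = 1 then
          Real.exp (π1 - π3) *
            ((1 - Real.exp (π22 w - π3)) / (1 - Real.exp (π22 w - π21 w)))
        else if y1 = 0 ∧ y2 = 3 then Real.exp (π1 - π3)
        else if y1 = 1 ∧ y2 = 1 then -1
        else if y1 = 1 ∧ y2 = 2 ∧ y3 = 0 then
          -((1 - Real.exp (π3 - π21 w)) / (1 - Real.exp (π22 w - π21 w)))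
        else if y1 = 1 ∧ y2 = 2 ∧ y3 = 1 then
          -((Real.exp (π21 w - π3) - 1) / (Real.exp (π21 w - π22 w) - 1))
        else 0) *
      p3 y3 y2 w *
      (if y2 = 1 then 1 - Lam (π21 w)
        else if y2 = 2 then Lam (π21 w) - Lam (π22 w)
        else Lam (π22 w)) *
      f y1 w *
      (if y1 = 1 then Lam π1 else 1 - Lam π1)) = 0 := by
  have hI : Finset.Icc 1 3 = ({1, 2, 3} : Finset ℕ) := by decide
  rw [Finset.sum_range_succ, Finset.sum_range_one]
  have h0 := hfsum 0 (by simp)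
  have h1 := hfsum 1 (by simp)
  have key : Real.exp π1 * (1 - Lam π3) * (1 - Lam π1) + -(1 - Lam π3) * Lam π1 = 0 := by
    rw [Lam_eq π1]
    have := Real.exp_pos π1
    field_simp
    ring
  refine Eq.trans (congrArg₂ (· + ·) ?_ ?_) key
  · refine Eq.trans ?_ ((congrArg (Real.exp π1 * (1 - Lam π3) * (1 - Lam π1) * ·) h0).trans
      (mul_one _))
    simp only [Finset.mul_sum]
    refine Finset.sum_congr rfl fun w hw => ?_
    have h3 := hp3sum 3 (by simp) w hw
    simp [hI, Finset.sum_range_succ, hp3two0 w hw, hp3two1 w hw]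
    linear_combination (f 0 w * (1 - Lam π1)) * core0 π1 π3 _ _ (hπ w hw)
      + Real.exp (π1 - π3) * Lam (π22 w) * f 0 w * (1 - Lam π1) * h3
  · refine Eq.trans ?_ ((congrArg (-(1 - Lam π3) * Lam π1 * ·) h1).trans (mul_one _))
    simp only [Finset.mul_sum]
    refine Finset.sum_congr rfl fun w hw => ?_
    have h3 := hp3sum 1 (by simp) w hw
    simp [hI, Finset.sum_range_succ, hp3two0 w hw, hp3two1 w hw]
    linear_combination (f 1 w * Lam π1) * core1 π3 _ _ (hπ w hw)
      - (1 - Lam (π21 w)) * f 1 w * Lam π1 * h3
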